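/- arXiv:1804.04904 — 2 statements merged into one kernel-verified Lean document; each statement's English description precedes it below -/
import Mathlib

section
/- Fix integers N_r ≥ 1, N_θ ≥ 1, reals Δr, Δθ > 0 and R_min > 0, and set r_j = R_min + (j − 1/2)Δr for j = 0,1,…,N_r+1 and r_{j+1/2} = R_min + jΔr for j = 0,…,N_r. Suppose p : {1,…,N_r} × ℤ/N_θℤ → ℝ satisfies, for all 1 ≤ j ≤ N_r and all k ∈ ℤ/N_θℤ, the homogeneous finite-volume equation (1/Δr²) [ −(r_{j−1/2}/r_{j−1}) p_{j−1,k} + ((r_{j−1/2} + r_{j+1/2})/r_j) p_{j,k} − (r_{j+1/2}/r_{j+1}) p_{j+1,k} ] + (1/(r_j² Δθ²)) [ −p_{j,k−1} + 2 p_{j,k} − p_{j,k+1} ] = 0, with the ghost-value conventions p_{0,k} = 0 and p_{N_r+1,k} = 0 and periodic angular index k. Then p_{j,k} = 0 for all j,k. Consequently, the discrete Poisson problem for the pressure has at most one solution for any right-hand side and any Dirichlet boundary data. -/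
/-- The finite volume operator of the polar pressure problem on the annulus, with cell
centers `r_j = R_min + (j − 1/2) Δr` and faces `r_{j+1/2} = R_min + j Δr`, acting on a grid
function `p` (indexed by a radial index in `ℕ`, including ghost indices `0` and `N_r + 1`,
and a periodic angular index in `ℤ/N_θℤ`). -/
noncomputable def poissonFVOp (Nθ : ℕ) (Rmin Δr Δθ : ℝ)
    (p : ℕ → ZMod Nθ → ℝ) (j : ℕ) (k : ZMod Nθ) : ℝ :=
  let r : ℕ → ℝ := fun i => Rmin + ((i : ℝ) - 1 / 2) * Δr
  let rh : ℕ → ℝ := fun i => Rmin + (i : ℝ) * Δr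
  (1 / Δr ^ 2) * (-(rh (j - 1) / r (j - 1)) * p (j - 1) k
      + ((rh (j - 1) + rh j) / r j) * p j k - (rh j / r (j + 1)) * p (j + 1) k)
    + (1 / ((r j) ^ 2 * Δθ ^ 2)) * (-p j (k - 1) + 2 * p j k - p j (k + 1))

theorem fv_nonpos
    (Nr Nθ : ℕ) [NeZero Nθ]
    (Δr Δθ Rmin : ℝ) (hΔr : 0 < Δr) (hΔθ : 0 < Δθ) (hRmin : 0 < Rmin)
    (p : ℕ → ZMod Nθ → ℝ)
    (hghost0 : ∀ k, p 0 k = 0) (hghostN : ∀ k, p (Nr + 1) k = 0)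
    (heq : ∀ j, 1 ≤ j → j ≤ Nr → ∀ k, poissonFVOp Nθ Rmin Δr Δθ p j k = 0) :
    ∀ j, 1 ≤ j → j ≤ Nr → ∀ k, p j k ≤ 0 := by
  obtain ⟨r, hr⟩ : ∃ r : ℕ → ℝ, r = fun i : ℕ => Rmin + ((i : ℝ) - 1 / 2) * Δr := ⟨_, rfl⟩
  obtain ⟨rh, hrh⟩ : ∃ rh : ℕ → ℝ, rh = fun i : ℕ => Rmin + (i : ℝ) * Δr := ⟨_, rfl⟩
  have hrpos : ∀ i, 0 < r (i + 1) := by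
    intro i
    simp only [hr]
    push_cast
    have : (0 : ℝ) ≤ i := Nat.cast_nonneg i
    have : 0 < ((i : ℝ) + 1 - 1 / 2) * Δr := by
      apply mul_pos _ hΔr
      linarith
    linarith
  have hrhpos : ∀ i, 0 < rh i := by
    intro i
    simp only [hrh]
    positivity
  obtain ⟨u, hu⟩ : ∃ u : ℕ → ZMod Nθ → ℝ, u = fun i k => p i k / r i := ⟨_, rfl⟩
  have hu0 : ∀ k, u 0 k = 0 := by intro k; simp [hu, hghost0]
  have huN : ∀ k, u (Nr + 1) k = 0 := by intro k; simp [hu, hghostN]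
  have hpu : ∀ i k, p (i + 1) k = r (i + 1) * u (i + 1) k := by
    intro i k
    simp only [hu]
    field_simp [(hrpos i).ne']
  have heq' : ∀ i, i + 1 ≤ Nr → ∀ k,
      (1 / Δr ^ 2) * (rh i * (u (i + 1) k - u i k) + rh (i + 1) * (u (i + 1) k - u (i + 2) k))
      + (r (i + 1) / ((r (i + 1)) ^ 2 * Δθ ^ 2)) *
        ((u (i + 1) k - u (i + 1) (k - 1)) + (u (i + 1) k - u (i + 1) (k + 1))) = 0 := by
    intro i hi k
    have h := heq (i + 1) (by omega) hi k
    have h2 : poissonFVOp Nθ Rmin Δr Δθ p (i + 1) k =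
      (1 / Δr ^ 2) * (-(rh i / r i) * p i k
      + ((rh i + rh (i + 1)) / r (i + 1)) * p (i + 1) k - (rh (i + 1) / r (i + 2)) * p (i + 2) k)
    + (1 / ((r (i + 1)) ^ 2 * Δθ ^ 2)) *
      (-p (i + 1) (k - 1) + 2 * p (i + 1) k - p (i + 1) (k + 1)) := by
      subst hr hrh
      rfl
    have e1 : ((rh i + rh (i + 1)) / r (i + 1)) * p (i + 1) k
        = (rh i + rh (i + 1)) * u (i + 1) k := by simp only [hu]; ring
    have e2 : (rh (i + 1) / r (i + 2)) * p (i + 2) k = rh (i + 1) * u (i + 2) k := by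
      simp only [hu]; ring
    have e3 : -(rh i / r i) * p i k = - (rh i * u i k) := by simp only [hu]; ring
    rw [h2, e1, e2, e3, hpu i k, hpu i (k - 1), hpu i (k + 1)] at h
    rw [← h]
    ring
  obtain ⟨⟨j0, k0⟩, hm, hmax⟩ := Finset.exists_max_image
    (Finset.range (Nr + 2) ×ˢ (Finset.univ : Finset (ZMod Nθ))) (fun x => u x.1 x.2)
    ⟨(0, 0), by simp⟩
  have hmax' : ∀ j k, j ≤ Nr + 1 → u j k ≤ u j0 k0 := by
    intro j k hj
    exact hmax (j, k) (by simp; omega)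
  have hj0 : j0 ≤ Nr + 1 := by
    simp at hm; omega
  have key : ∀ j, j ≤ Nr → ∀ k, u j k = u j0 k0 → u j0 k0 = 0 := by
    intro j
    induction j with
    | zero => intro _ k h; rw [← h, hu0]
    | succ i ih =>
      intro hi k h
      apply ih (by omega) k
      have h1 := heq' i hi k
      have a1 := hmax' i k (by omega)
      have a2 := hmax' (i + 2) k (by omega)
      have a3 := hmax' (i + 1) (k - 1) (by omega)
      have a4 := hmax' (i + 1) (k + 1) (by omega)
      rw [h] at h1
      have c1 : 0 < 1 / Δr ^ 2 := by positivity
      have c2 : 0 < r (i + 1) / ((r (i + 1)) ^ 2 * Δθ ^ 2) := by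
        have := hrpos i
        positivity
      by_contra hne
      have a1' : 0 < u j0 k0 - u i k := by
        have := lt_of_le_of_ne a1 hne
        linarith
      have b1 := mul_pos (hrhpos i) a1'
      have b2 := mul_nonneg (hrhpos (i + 1)).le (sub_nonneg.2 a2)
      have b3 := mul_pos c1 (add_pos_of_pos_of_nonneg b1 b2)
      have b4 := mul_nonneg c2.le (add_nonneg (sub_nonneg.2 a3) (sub_nonneg.2 a4))
      linarith
  have hM : u j0 k0 = 0 := by
    rcases Nat.lt_or_ge Nr j0 with h | h
    · have : j0 = Nr + 1 := by omega
      rw [this, huN]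
    · exact key j0 h k0 rfl
  intro j hj hjN k
  obtain ⟨i, rfl⟩ : ∃ i, j = i + 1 := ⟨j - 1, by omega⟩
  rw [hpu]
  have := hmax' (i + 1) k (by omega)
  rw [hM] at this
  exact mul_nonpos_of_nonneg_of_nonpos (hrpos i).le this

theorem fv_sub (Nθ : ℕ) (Rmin Δr Δθ : ℝ) (q q' : ℕ → ZMod Nθ → ℝ) (j : ℕ) (k : ZMod Nθ) :
    poissonFVOp Nθ Rmin Δr Δθ (fun j k => q j k - q' j k) j k =
      poissonFVOp Nθ Rmin Δr Δθ q j k - poissonFVOp Nθ Rmin Δr Δθ q' j k := by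
  simp only [poissonFVOp]
  ring

/-- If a grid function satisfies the homogeneous finite-volume pressure
equations with zero ghost values `p_{0,k} = p_{N_r+1,k} = 0`, then it vanishes identically;
consequently, the discrete Poisson problem for the pressure has at most one solution for any
right-hand side and any Dirichlet boundary data. -/
theorem discrete_poisson_uniqueness
    (Nr Nθ : ℕ) (hNr : 1 ≤ Nr) [NeZero Nθ]
    (Δr Δθ Rmin : ℝ) (hΔr : 0 < Δr) (hΔθ : 0 < Δθ) (hRmin : 0 < Rmin)
    (p : ℕ → ZMod Nθ → ℝ)
    (hghost0 : ∀ k, p 0 k = 0) (hghostN : ∀ k, p (Nr + 1) k = 0)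
    (heq : ∀ j, 1 ≤ j → j ≤ Nr → ∀ k, poissonFVOp Nθ Rmin Δr Δθ p j k = 0) :
    (∀ j, 1 ≤ j → j ≤ Nr → ∀ k, p j k = 0)
      ∧ ∀ (f : ℕ → ZMod Nθ → ℝ) (g0 gN : ZMod Nθ → ℝ) (q q' : ℕ → ZMod Nθ → ℝ),
          (∀ k, q 0 k = g0 k) → (∀ k, q (Nr + 1) k = gN k) →
          (∀ k, q' 0 k = g0 k) → (∀ k, q' (Nr + 1) k = gN k) →
          (∀ j, 1 ≤ j → j ≤ Nr → ∀ k, poissonFVOp Nθ Rmin Δr Δθ q j k = f j k) →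
          (∀ j, 1 ≤ j → j ≤ Nr → ∀ k, poissonFVOp Nθ Rmin Δr Δθ q' j k = f j k) →
          ∀ j, 1 ≤ j → j ≤ Nr → ∀ k, q j k = q' j k := by
  have main : ∀ (f : ℕ → ZMod Nθ → ℝ) (g0 gN : ZMod Nθ → ℝ) (q q' : ℕ → ZMod Nθ → ℝ),
          (∀ k, q 0 k = g0 k) → (∀ k, q (Nr + 1) k = gN k) →
          (∀ k, q' 0 k = g0 k) → (∀ k, q' (Nr + 1) k = gN k) →
          (∀ j, 1 ≤ j → j ≤ Nr → ∀ k, poissonFVOp Nθ Rmin Δr Δθ q j k = f j k) →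
          (∀ j, 1 ≤ j → j ≤ Nr → ∀ k, poissonFVOp Nθ Rmin Δr Δθ q' j k = f j k) →
          ∀ j, 1 ≤ j → j ≤ Nr → ∀ k, q j k ≤ q' j k := by
    intro f g0 gN q q' h1 h2 h3 h4 h5 h6 j hj hjN k
    have := fv_nonpos Nr Nθ Δr Δθ Rmin hΔr hΔθ hRmin (fun j k => q j k - q' j k)
      (by intro k; simp [h1, h3]) (by intro k; simp [h2, h4])
      (by intro j hj hjN k; rw [fv_sub, h5 j hj hjN, h6 j hj hjN, sub_self]) j hj hjN k
    simpa using this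
  have z : ∀ j k, poissonFVOp Nθ Rmin Δr Δθ (fun _ _ => 0) j k = 0 := by
    intro j k
    simp [poissonFVOp]
  refine ⟨fun j hj hjN k => le_antisymm ?_ ?_, ?_⟩
  · exact main (fun _ _ => 0) (fun _ => 0) (fun _ => 0) p (fun _ _ => 0) hghost0 hghostN
      (fun _ => rfl) (fun _ => rfl) heq (fun j _ _ k => z j k) j hj hjN k
  · exact main (fun _ _ => 0) (fun _ => 0) (fun _ => 0) (fun _ _ => 0) p (fun _ => rfl)
      (fun _ => rfl) hghost0 hghostN (fun j _ _ k => z j k) heq j hj hjN k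
  · intro f g0 gN q q' h1 h2 h3 h4 h5 h6 j hj hjN k
    exact le_antisymm (main f g0 gN q q' h1 h2 h3 h4 h5 h6 j hj hjN k)
      (main f g0 gN q' q h3 h4 h1 h2 h6 h5 j hj hjN k)
end

section
/- Fix integers N_r ≥ 1, N_θ ≥ 1, reals Δr, Δθ, Δt > 0, D > 0, k_on, k_off ≥ 0, R_min > 0, and set r_j = R_min + (j − 1/2)Δr for j = 1,…,N_r and r_{j+1/2} = R_min + jΔr for j = 0,…,N_r. Suppose c : {1,…,N_r} × ℤ/N_θℤ → ℝ and μ : ℤ/N_θℤ → ℝ satisfy the homogeneous implicit system of the scheme: for 1 ≤ j ≤ N_r and all k (with periodic angular index, zero diffusive flux at the inner face j = 1/2, and the exchange flux k_off μ_k − k_on c_{N_r,k} at the outer face j = N_r + 1/2), c_{j,k} − (Δt/Δr) ( F_{j+1/2,k} − F_{j−1/2,k} ) − (Δt/Δθ) ( G_{j,k+1/2} − G_{j,k−1/2} ) = 0, where F_{j+1/2,k} = D r_{j+1/2} ( c_{j+1,k}/r_{j+1} − c_{j,k}/r_j )/Δr for 1 ≤ j ≤ N_r−1, F_{1/2,k}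 = 0, F_{N_r+1/2,k} = k_off μ_k − k_on c_{N_r,k}, and G_{j,k+1/2} = (D/(r_j² Δθ)) ( c_{j,k+1} − c_{j,k} ); and (1 + Δt k_off) μ_k − Δt k_on c_{N_r,k} = 0 for all k. Then c = 0 and μ = 0. Consequently, each implicit time step of the scheme for the concentrations has at most one solution. -/
/-- The implicit operator of one time step of the finite volume scheme for the concentration:
diffusion and the boundary activation/deactivation exchange are implicit, with cell centers
`r_j = R_min + (j − 1/2) Δr`, faces `r_{j+1/2} = R_min + j Δr`, zero diffusive flux at the
inner face `j = 1/2`, the exchange flux `k_off μ − k_on c_{N_r}` at the outer face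
`j = N_r + 1/2`, and periodic angular index. -/
noncomputable def implicitFVOp (Nθ Nr : ℕ) (Rmin Δr Δθ Δt D kon koff : ℝ)
    (c : ℕ → ZMod Nθ → ℝ) (μ : ZMod Nθ → ℝ) (j : ℕ) (k : ZMod Nθ) : ℝ :=
  let r : ℕ → ℝ := fun i => Rmin + ((i : ℝ) - 1 / 2) * Δr
  let rh : ℕ → ℝ := fun i => Rmin + (i : ℝ) * Δr
  let F : ℕ → ZMod Nθ → ℝ := fun i k' =>
    if i = 0 then 0
    else if i = Nr then koff * μ k' - kon * c Nr k'
    else D * rh i * (c (i + 1) k' / r (i + 1) - c i k' / r i) / Δr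
  let G : ℕ → ZMod Nθ → ℝ := fun i k' => (D / ((r i) ^ 2 * Δθ)) * (c i (k' + 1) - c i k')
  c j k - (Δt / Δr) * (F j k - F (j - 1) k) - (Δt / Δθ) * (G j k - G j (k - 1))

/-- The implicit boundary activation equation of one time step of the scheme:
`(1 + Δt k_off) μ_k − Δt k_on c_{N_r,k}`. -/
def implicitFVOpμ (Nθ Nr : ℕ) (Δt kon koff : ℝ)
    (c : ℕ → ZMod Nθ → ℝ) (μ : ZMod Nθ → ℝ) (k : ZMod Nθ) : ℝ :=
  (1 + Δt * koff) * μ k - Δt * kon * c Nr k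

theorem implicitFVOp_sub (Nθ Nr : ℕ) (Rmin Δr Δθ Δt D kon koff : ℝ)
    (c₁ c₂ : ℕ → ZMod Nθ → ℝ) (μ₁ μ₂ : ZMod Nθ → ℝ) (j : ℕ) (k : ZMod Nθ) :
    implicitFVOp Nθ Nr Rmin Δr Δθ Δt D kon koff (fun j k => c₁ j k - c₂ j k)
      (fun k => μ₁ k - μ₂ k) j k
    = implicitFVOp Nθ Nr Rmin Δr Δθ Δt D kon koff c₁ μ₁ j k
      - implicitFVOp Nθ Nr Rmin Δr Δθ Δt D kon koff c₂ μ₂ j k := by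
  unfold implicitFVOp
  dsimp only
  split_ifs <;> ring

theorem implicitFV_nonpos
    (Nr Nθ : ℕ) [NeZero Nθ]
    (Δr Δθ Δt : ℝ) (hΔr : 0 < Δr) (hΔθ : 0 < Δθ) (hΔt : 0 < Δt)
    (D kon koff Rmin : ℝ) (hD : 0 < D) (hkon : 0 ≤ kon) (hkoff : 0 ≤ koff) (hRmin : 0 < Rmin)
    (c : ℕ → ZMod Nθ → ℝ) (μ : ZMod Nθ → ℝ)
    (hc : ∀ j, 1 ≤ j → j ≤ Nr → ∀ k,
      implicitFVOp Nθ Nr Rmin Δr Δθ Δt D kon koff c μ j k = 0)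
    (hμ : ∀ k, implicitFVOpμ Nθ Nr Δt kon koff c μ k = 0) :
    ∀ j, 1 ≤ j → j ≤ Nr → ∀ k, c j k ≤ 0 := by
  intro j₀ h1 h2 k₀
  have rpos : ∀ i : ℕ, 1 ≤ i → 0 < Rmin + ((i : ℝ) - 1 / 2) * Δr := by
    intro i hi
    have : (1 : ℝ) ≤ i := by exact_mod_cast hi
    have : 0 < ((i : ℝ) - 1 / 2) * Δr := mul_pos (by linarith) hΔr
    linarith
  obtain ⟨⟨j, k⟩, hm, hmax⟩ := Finset.exists_max_image
    ((Finset.Icc 1 Nr) ×ˢ (Finset.univ : Finset (ZMod Nθ)))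
    (fun p => c p.1 p.2 / (Rmin + ((p.1 : ℝ) - 1 / 2) * Δr))
    ⟨(j₀, k₀), by simp [h1, h2]⟩
  simp only [Finset.mem_product, Finset.mem_Icc, Finset.mem_univ, and_true] at hm
  have hmax' : ∀ i l, 1 ≤ i → i ≤ Nr → c i l / (Rmin + ((i : ℝ) - 1 / 2) * Δr)
      ≤ c j k / (Rmin + ((j : ℝ) - 1 / 2) * Δr) := fun i l hi hi' =>
    hmax (i, l) (by simp [hi, hi'])
  clear hmax
  by_contra! hpos
  have hr := rpos j hm.1
  have hcj : 0 < c j k := by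
    have h3 := div_pos hpos (rpos j₀ h1)
    have h4 := lt_of_lt_of_le h3 (hmax' j₀ k₀ h1 h2)
    exact (div_pos_iff_of_pos_right hr).1 h4
  have hang : ∀ l, c j l ≤ c j k := fun l =>
    (div_le_div_iff_of_pos_right hr).1 (hmax' j l hm.1 hm.2)
  have key := hc j hm.1 hm.2 k
  unfold implicitFVOp at key
  dsimp only at key
  rw [sub_add_cancel] at key
  have hG : ∀ x, x ≤ 0 → D / ((Rmin + ((j : ℝ) - 1 / 2) * Δr) ^ 2 * Δθ) * x ≤ 0 := fun x hx =>
    mul_nonpos_of_nonneg_of_nonpos (by positivity) hx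
  have g1 := hG (c j (k + 1) - c j k) (by linarith [hang (k + 1)])
  have g2 := hG (c j (k - 1) - c j k) (by linarith [hang (k - 1)])
  have hF1 : (if j = 0 then 0
    else if j = Nr then koff * μ k - kon * c Nr k
    else D * (Rmin + (j : ℝ) * Δr) * (c (j + 1) k / (Rmin + (((j + 1 : ℕ) : ℝ) - 1 / 2) * Δr)
      - c j k / (Rmin + ((j : ℝ) - 1 / 2) * Δr)) / Δr) ≤ 0 := by
    rw [if_neg (by omega)]
    split_ifs with h
    · subst h
      have hk := hμ k
      unfold implicitFVOpμ at hk
      have hd : 0 < 1 + Δt * koff := by positivity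
      have h5 : (koff * μ k - kon * c j k) * (1 + Δt * koff) = - (kon * c j k) := by
        linear_combination koff * hk
      have h6 : 0 ≤ kon * c j k := by positivity
      by_contra! h7
      have := mul_pos h7 hd
      linarith
    · have := hmax' (j + 1) k (by omega) (by omega)
      apply div_nonpos_of_nonpos_of_nonneg _ hΔr.le
      exact mul_nonpos_of_nonneg_of_nonpos (by positivity) (by linarith)
  have hF2 : 0 ≤ (if j - 1 = 0 then 0
    else if j - 1 = Nr then koff * μ k - kon * c Nr k
    else D * (Rmin + ((j - 1 : ℕ) : ℝ) * Δr) *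
      (c (j - 1 + 1) k / (Rmin + (((j - 1 + 1 : ℕ) : ℝ) - 1 / 2) * Δr)
      - c (j - 1) k / (Rmin + (((j - 1 : ℕ) : ℝ) - 1 / 2) * Δr)) / Δr) := by
    split_ifs with h h'
    · exact le_rfl
    · omega
    · have := hmax' (j - 1) k (by omega) (by omega)
      rw [Nat.sub_add_cancel hm.1]
      apply div_nonneg _ hΔr.le
      exact mul_nonneg (by positivity) (by linarith)
  have a1 := mul_nonpos_of_nonneg_of_nonpos (div_pos hΔt hΔr).le
    (sub_nonpos.2 (hF1.trans hF2))
  have a2 := mul_nonpos_of_nonneg_of_nonpos (div_pos hΔt hΔθ).le (add_nonpos g1 g2)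
  linarith

theorem implicitFV_le
    (Nr Nθ : ℕ) [NeZero Nθ]
    (Δr Δθ Δt : ℝ) (hΔr : 0 < Δr) (hΔθ : 0 < Δθ) (hΔt : 0 < Δt)
    (D kon koff Rmin : ℝ) (hD : 0 < D) (hkon : 0 ≤ kon) (hkoff : 0 ≤ koff) (hRmin : 0 < Rmin)
    (c₁ c₂ : ℕ → ZMod Nθ → ℝ) (μ₁ μ₂ : ZMod Nθ → ℝ)
    (hc : ∀ j, 1 ≤ j → j ≤ Nr → ∀ k,
      implicitFVOp Nθ Nr Rmin Δr Δθ Δt D kon koff c₁ μ₁ j k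
        = implicitFVOp Nθ Nr Rmin Δr Δθ Δt D kon koff c₂ μ₂ j k)
    (hμ : ∀ k, implicitFVOpμ Nθ Nr Δt kon koff c₁ μ₁ k
      = implicitFVOpμ Nθ Nr Δt kon koff c₂ μ₂ k) :
    ∀ j, 1 ≤ j → j ≤ Nr → ∀ k, c₁ j k ≤ c₂ j k := by
  intro j h1 h2 k
  have := implicitFV_nonpos Nr Nθ Δr Δθ Δt hΔr hΔθ hΔt D kon koff Rmin hD hkon hkoff hRmin
    (fun j k => c₁ j k - c₂ j k) (fun k => μ₁ k - μ₂ k)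
    (fun j h1 h2 k => by rw [implicitFVOp_sub, hc j h1 h2 k, sub_self])
    (fun k => by
      have := hμ k
      unfold implicitFVOpμ at this ⊢
      linear_combination this) j h1 h2 k
  simpa using this

theorem implicitFV_unique
    (Nr Nθ : ℕ) (hNr : 1 ≤ Nr) [NeZero Nθ]
    (Δr Δθ Δt : ℝ) (hΔr : 0 < Δr) (hΔθ : 0 < Δθ) (hΔt : 0 < Δt)
    (D kon koff Rmin : ℝ) (hD : 0 < D) (hkon : 0 ≤ kon) (hkoff : 0 ≤ koff) (hRmin : 0 < Rmin)
    (c₁ c₂ : ℕ → ZMod Nθ → ℝ) (μ₁ μ₂ : ZMod Nθ → ℝ)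
    (hc : ∀ j, 1 ≤ j → j ≤ Nr → ∀ k,
      implicitFVOp Nθ Nr Rmin Δr Δθ Δt D kon koff c₁ μ₁ j k
        = implicitFVOp Nθ Nr Rmin Δr Δθ Δt D kon koff c₂ μ₂ j k)
    (hμ : ∀ k, implicitFVOpμ Nθ Nr Δt kon koff c₁ μ₁ k
      = implicitFVOpμ Nθ Nr Δt kon koff c₂ μ₂ k) :
    (∀ j, 1 ≤ j → j ≤ Nr → ∀ k, c₁ j k = c₂ j k) ∧ (∀ k, μ₁ k = μ₂ k) := by
  have hcc : ∀ j, 1 ≤ j → j ≤ Nr → ∀ k, c₁ j k = c₂ j k := fun j h1 h2 k => le_antisymm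
    (implicitFV_le Nr Nθ Δr Δθ Δt hΔr hΔθ hΔt D kon koff Rmin hD hkon hkoff hRmin
      c₁ c₂ μ₁ μ₂ hc hμ j h1 h2 k)
    (implicitFV_le Nr Nθ Δr Δθ Δt hΔr hΔθ hΔt D kon koff Rmin hD hkon hkoff hRmin
      c₂ c₁ μ₂ μ₁ (fun j h1 h2 k => (hc j h1 h2 k).symm) (fun k => (hμ k).symm) j h1 h2 k)
  refine ⟨hcc, fun k => ?_⟩
  have hk := hμ k
  unfold implicitFVOpμ at hk
  rw [hcc Nr hNr le_rfl k] at hk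
  have hd : 0 < 1 + Δt * koff := by positivity
  exact mul_left_cancel₀ hd.ne' (by linarith)

/-- If `(c, μ)` satisfies the homogeneous implicit system of the finite
volume scheme, then `c = 0` and `μ = 0`; consequently, each implicit time step of the scheme
for the concentrations has at most one solution. -/
theorem discrete_implicit_step_uniqueness
    (Nr Nθ : ℕ) (hNr : 1 ≤ Nr) [NeZero Nθ]
    (Δr Δθ Δt : ℝ) (hΔr : 0 < Δr) (hΔθ : 0 < Δθ) (hΔt : 0 < Δt)
    (D kon koff Rmin : ℝ) (hD : 0 < D) (hkon : 0 ≤ kon) (hkoff : 0 ≤ koff) (hRmin : 0 < Rmin)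
    (c : ℕ → ZMod Nθ → ℝ) (μ : ZMod Nθ → ℝ)
    (hc : ∀ j, 1 ≤ j → j ≤ Nr → ∀ k,
      implicitFVOp Nθ Nr Rmin Δr Δθ Δt D kon koff c μ j k = 0)
    (hμ : ∀ k, implicitFVOpμ Nθ Nr Δt kon koff c μ k = 0) :
    ((∀ j, 1 ≤ j → j ≤ Nr → ∀ k, c j k = 0) ∧ (∀ k, μ k = 0))
      ∧ ∀ (ρ : ℕ → ZMod Nθ → ℝ) (σ : ZMod Nθ → ℝ)
          (c₁ c₂ : ℕ → ZMod Nθ → ℝ) (μ₁ μ₂ : ZMod Nθ → ℝ),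
          (∀ j, 1 ≤ j → j ≤ Nr → ∀ k,
            implicitFVOp Nθ Nr Rmin Δr Δθ Δt D kon koff c₁ μ₁ j k = ρ j k) →
          (∀ k, implicitFVOpμ Nθ Nr Δt kon koff c₁ μ₁ k = σ k) →
          (∀ j, 1 ≤ j → j ≤ Nr → ∀ k,
            implicitFVOp Nθ Nr Rmin Δr Δθ Δt D kon koff c₂ μ₂ j k = ρ j k) →
          (∀ k, implicitFVOpμ Nθ Nr Δt kon koff c₂ μ₂ k = σ k) →
          (∀ j, 1 ≤ j → j ≤ Nr → ∀ k, c₁ j k = c₂ j k) ∧ (∀ k, μ₁ k = μ₂ k) := by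
  refine ⟨?_, fun ρ σ c₁ c₂ μ₁ μ₂ h1 h2 h3 h4 => ?_⟩
  · exact implicitFV_unique Nr Nθ hNr Δr Δθ Δt hΔr hΔθ hΔt D kon koff Rmin hD hkon hkoff hRmin
      c (fun _ _ => 0) μ (fun _ => 0)
      (fun j a b k => by rw [hc j a b k]; simp [implicitFVOp])
      (fun k => by rw [hμ k]; simp [implicitFVOpμ])
  · exact implicitFV_unique Nr Nθ hNr Δr Δθ Δt hΔr hΔθ hΔt D kon koff Rmin hD hkon hkoff hRmin
      c₁ c₂ μ₁ μ₂ (fun j a b k => by rw [h1 j a b k, h3 j a b k])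
      (fun k => by rw [h2 k, h4 k])
end
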